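/- Let N be the nest {0} = N₀ < N₁ < N₂ < ⋯ on H with atoms Eₖ = P(Nₖ) − P(Nₖ₋₁) of finite rank nₖ satisfying nₖ ≥ 4·Σ_{i<k} nᵢ. Then the right topological stable rank of the nest algebra T(N) equals 2: for any A, B ∈ T(N) and ε > 0 there exist A'', B' ∈ T(N) with ‖A − A''‖ < ε, ‖B − B'‖ < ε, and operators X, Y ∈ T(N) with A''X + B'Y = I; moreover rtsr(T(N)) ≥ 2. -/

import Mathlib

/-- `n`-tuples generating `A` as a left ideal. -/
noncomputable def Lg (A : Type*) [NormedRing A] (n : ℕ) : Set (Fin n → A) :=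
  {a | ∃ b : Fin n → A, ∑ i, b i * a i = 1}

/-- `n`-tuples generating `A` as a right ideal. -/
noncomputable def Rg (A : Type*) [NormedRing A] (n : ℕ) : Set (Fin n → A) :=
  {a | ∃ b : Fin n → A, ∑ i, a i * b i = 1}

/-- The left topological stable rank. -/
noncomputable def ltsr (A : Type*) [NormedRing A] : ℕ∞ :=
  sInf {N : ℕ∞ | ∃ n : ℕ, N = n ∧ Dense (Lg A n)}

/-- The right topological stable rank. -/
noncomputable def rtsr (A : Type*) [NormedRing A] : ℕ∞ :=
  sInf {N : ℕ∞ | ∃ n : ℕ, N = n ∧ Dense (Rg A n)}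


/-- A nest: a chain of closed subspaces containing `{0}` and `H`, closed under
intersections and closed linear spans. -/
structure IsNest {H : Type*} [NormedAddCommGroup H] [InnerProductSpace ℂ H]
    (𝒩 : Set (Submodule ℂ H)) : Prop where
  isClosed : ∀ N ∈ 𝒩, IsClosed (N : Set H)
  isChain : IsChain (· ≤ ·) 𝒩
  bot_mem : ⊥ ∈ 𝒩
  top_mem : ⊤ ∈ 𝒩
  sInf_mem : ∀ S ⊆ 𝒩, S.Nonempty → sInf S ∈ 𝒩
  span_mem : ∀ S ⊆ 𝒩, S.Nonempty → (sSup S).topologicalClosure ∈ 𝒩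

/-- The nest algebra of all bounded operators leaving every subspace of `𝒩` invariant. -/
noncomputable def nestAlgebra {H : Type*} [NormedAddCommGroup H] [InnerProductSpace ℂ H]
    (𝒩 : Set (Submodule ℂ H)) : Subalgebra ℂ (H →L[ℂ] H) where
  carrier := {T | ∀ N ∈ 𝒩, ∀ x ∈ N, T x ∈ N}
  mul_mem' := fun hT hS N hN x hx => hT N hN _ (hS N hN x hx)
  add_mem' := fun hT hS N hN x hx => N.add_mem (hT N hN x hx) (hS N hN x hx)
  algebraMap_mem' := fun c N hN x hx => by
    simpa [Algebra.algebraMap_eq_smul_one] using N.smul_mem c hx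

open scoped InnerProductSpace

section core
variable {V W : Type*} [NormedAddCommGroup V] [InnerProductSpace ℂ V]
  [NormedAddCommGroup W] [InnerProductSpace ℂ W]

lemma diagOp_exists {ι : Type*} [Fintype ι] {b : ι → V} {w : ι → W}
    (hb : Orthonormal ℂ b) (hw : Orthonormal ℂ w) (c : ι → ℂ) (C : ℝ) (hC : 0 ≤ C)
    (hc : ∀ i, ‖c i‖ ≤ C) :
    ∃ D : V →L[ℂ] W, ‖D‖ ≤ C ∧ ∀ v, D v = ∑ i, (c i * ⟪b i, v⟫_ℂ) • w i := by
  refine ⟨∑ i, c i • (innerSL ℂ (b i)).smulRight (w i), ?_, ?_⟩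
  · refine ContinuousLinearMap.opNorm_le_bound _ hC fun v => ?_
    have h1 : (∑ i, c i • (innerSL ℂ (b i)).smulRight (w i)) v
        = ∑ i, (c i * ⟪b i, v⟫_ℂ) • w i := by
      simp [smul_smul]
    rw [h1]
    refine le_of_sq_le_sq ?_ (by positivity)
    have h2 : ‖∑ i, (c i * ⟪b i, v⟫_ℂ) • w i‖ ^ 2 = ∑ i, ‖c i * ⟪b i, v⟫_ℂ‖ ^ 2 := by
      have := hw.inner_sum (fun i => c i * ⟪b i, v⟫_ℂ) (fun i => c i * ⟪b i, v⟫_ℂ) Finset.univ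
      rw [inner_self_eq_norm_sq_to_K] at this
      simp only [RCLike.conj_mul] at this
      exact_mod_cast this
    rw [h2, mul_pow]
    calc ∑ i, ‖c i * ⟪b i, v⟫_ℂ‖ ^ 2 ≤ ∑ i, C ^ 2 * ‖⟪b i, v⟫_ℂ‖ ^ 2 := by
          gcongr with i
          rw [norm_mul, mul_pow]
          gcongr
          exact hc i
      _ = C ^ 2 * ∑ i, ‖⟪b i, v⟫_ℂ‖ ^ 2 := by rw [Finset.mul_sum]
      _ ≤ C ^ 2 * ‖v‖ ^ 2 := by
          gcongr
          exact hb.sum_inner_products_le v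
  · intro v
    simp [smul_smul]

lemma core_perturb [FiniteDimensional ℂ V] [FiniteDimensional ℂ W] (T : V →L[ℂ] W)
    (hd : Module.finrank ℂ W ≤ Module.finrank ℂ V) (δ : ℝ) (hδ : 0 < δ) :
    ∃ (U : V →L[ℂ] W) (R : W →L[ℂ] V), ‖U‖ ≤ δ ∧ ‖R‖ ≤ δ⁻¹ ∧ ∀ w, (T + U) (R w) = w := by
  have := FiniteDimensional.complete ℂ V
  have := FiniteDimensional.complete ℂ W
  set S := ContinuousLinearMap.adjoint T with hS
  have hsym : ((T ∘L S : W →L[ℂ] W) : W →ₗ[ℂ] W).IsSymmetric := by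
    intro x y
    simp only [ContinuousLinearMap.coe_coe, ContinuousLinearMap.comp_apply]
    rw [← ContinuousLinearMap.adjoint_inner_right, ← hS, hS, ContinuousLinearMap.adjoint_inner_left]
  set w := hsym.eigenvectorBasis rfl with hw
  have hwi : ∀ i j, i ≠ j → ⟪S (w i), S (w j)⟫_ℂ = 0 := by
    intro i j hij
    rw [hS, ContinuousLinearMap.adjoint_inner_left]
    have := hsym.apply_eigenvectorBasis rfl j
    simp only [ContinuousLinearMap.coe_coe, ContinuousLinearMap.comp_apply] at this
    rw [← hw] at this
    rw [← hS, this, inner_smul_right, w.orthonormal.2 hij, mul_zero]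
  let e : Fin (Module.finrank ℂ W) → Fin (Module.finrank ℂ V) := Fin.castLE hd
  have he : Function.Injective e := Fin.castLE_injective hd
  let v : Fin (Module.finrank ℂ V) → V := fun j =>
    if h : j.1 < Module.finrank ℂ W then
      ((‖S (w ⟨j.1, h⟩)‖ : ℂ)⁻¹) • S (w ⟨j.1, h⟩) else 0
  have hve : ∀ i, v (e i) = ((‖S (w i)‖ : ℂ)⁻¹) • S (w i) := by
    intro i; simp [v, e]
  let s : Set (Fin (Module.finrank ℂ V)) := {j | ∃ i, e i = j ∧ S (w i) ≠ 0}
  have hon : Orthonormal ℂ (s.domRestrict v) := by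
    constructor
    · rintro ⟨j, i, rfl, hi⟩
      simp only [Set.domRestrict_apply, hve]
      rw [norm_smul]
      have := norm_ne_zero_iff.2 hi
      simp [this]
    · rintro ⟨j, i, rfl, hi⟩ ⟨j', i', rfl, hi'⟩ hne
      have : i ≠ i' := by rintro rfl; exact hne rfl
      simp only [Set.domRestrict_apply, hve]
      rw [inner_smul_left, inner_smul_right, hwi _ _ this]; simp
  obtain ⟨b, hb⟩ := hon.exists_orthonormalBasis_extension_of_card_eq (by simp)
  have hSb : ∀ i, S (w i) = (‖S (w i)‖ : ℂ) • b (e i) := by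
    intro i
    by_cases h : S (w i) = 0
    · simp [h]
    · rw [hb (e i) ⟨i, rfl, h⟩, hve, smul_smul, mul_inv_cancel₀, one_smul]
      simpa using h
  have hbe : Orthonormal ℂ (b ∘ e) := b.orthonormal.comp e he
  obtain ⟨U, hU, hU'⟩ := diagOp_exists hbe w.orthonormal (fun _ => (δ : ℂ)) δ hδ.le
    (fun i => by simp [abs_of_pos hδ])
  obtain ⟨R, hR, hR'⟩ := diagOp_exists w.orthonormal hbe
    (fun i => ((‖S (w i)‖ + δ : ℝ) : ℂ)⁻¹) δ⁻¹ (by positivity) (fun i => by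
      have : 0 ≤ ‖S (w i)‖ + δ := by positivity
      rw [norm_inv, Complex.norm_real, Real.norm_of_nonneg this]
      gcongr
      simp)
  refine ⟨U, R, hU, hR, fun x => ?_⟩
  apply w.repr.injective
  ext i
  rw [w.repr_apply_apply, w.repr_apply_apply]
  have h1 : ⟪w i, T (R x)⟫_ℂ = (‖S (w i)‖ : ℂ) * ⟪b (e i), R x⟫_ℂ := by
    rw [← ContinuousLinearMap.adjoint_inner_left, ← hS]
    conv_lhs => rw [hSb i]
    rw [inner_smul_left]; simp
  have h2 : ⟪w i, U (R x)⟫_ℂ = δ * ⟪b (e i), R x⟫_ℂ := by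
    rw [hU', w.orthonormal.inner_right_fintype]; rfl
  have h3 : ⟪b (e i), R x⟫_ℂ = ((‖S (w i)‖ + δ : ℝ) : ℂ)⁻¹ * ⟪w i, x⟫_ℂ := by
    rw [hR']
    exact hbe.inner_right_fintype _ i
  have h4 : ((‖S (w i)‖ + δ : ℝ) : ℂ) ≠ 0 := by
    have : ‖S (w i)‖ + δ ≠ 0 := by positivity
    exact_mod_cast this
  rw [add_apply, inner_add_right, h1, h2, ← add_mul, h3, ← mul_assoc,
    ← Complex.ofReal_add, mul_inv_cancel₀ h4, one_mul]
end core

section block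
variable {H : Type*} [NormedAddCommGroup H] [InnerProductSpace ℂ H]

/-- The `k`-th atom. -/
noncomputable def atomE (N : ℕ → Submodule ℂ H) (k : ℕ) : Submodule ℂ H := (N k)ᗮ ⊓ N (k + 1)

/-- The projection on the `k`-th atom. -/
noncomputable def atomP (N : ℕ → Submodule ℂ H) [∀ k, FiniteDimensional ℂ (N k)] (k : ℕ) :
    H →L[ℂ] H := (N (k + 1)).starProjection - (N k).starProjection

variable (N : ℕ → Submodule ℂ H) [hfd : ∀ k, FiniteDimensional ℂ (N k)]

instance : ∀ k, FiniteDimensional ℂ (atomE N k) := fun k =>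
  Submodule.finiteDimensional_of_le (inf_le_right : atomE N k ≤ N (k + 1))

lemma atomP_apply (k : ℕ) (x : H) :
    atomP N k x = (N (k + 1)).starProjection x - (N k).starProjection x := rfl

lemma proj_proj {U V : Submodule ℂ H} [U.HasOrthogonalProjection] [V.HasOrthogonalProjection]
    (h : U ≤ V) (x : H) : U.starProjection (V.starProjection x) = U.starProjection x :=
  congrArg (fun f : H →L[ℂ] H => f x) (Submodule.starProjection_comp_starProjection_of_le h)

lemma proj_self {U V : Submodule ℂ H} [V.HasOrthogonalProjection]
    (h : U ≤ V) {x : H} (hx : x ∈ U) : V.starProjection x = x :=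
  Submodule.starProjection_eq_self_iff.2 (h hx)

lemma proj_orth {V : Submodule ℂ H} [V.HasOrthogonalProjection] {x : H} (hx : x ∈ Vᗮ) :
    V.starProjection x = 0 := by
  simpa using (Submodule.starProjection_apply_eq_zero_iff (K := V)).2 hx

lemma mem_orth_of_proj {V : Submodule ℂ H} [V.HasOrthogonalProjection] {x : H}
    (hx : V.starProjection x = 0) : x ∈ Vᗮ :=
  (Submodule.starProjection_apply_eq_zero_iff (K := V)).1 hx

lemma atomP_mem (hm : Monotone N) (k : ℕ) (x : H) : atomP N k x ∈ atomE N k := by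
  have hle := hm (Nat.le_succ k)
  refine ⟨mem_orth_of_proj ?_, ?_⟩
  · rw [atomP_apply, map_sub, proj_proj hle, proj_proj le_rfl, sub_self]
  · exact sub_mem (Submodule.starProjection_apply_mem _ _)
      (hle (Submodule.starProjection_apply_mem _ _))

lemma atomP_eq {k : ℕ} {x : H} (hx : x ∈ atomE N k) : atomP N k x = x := by
  rw [atomP_apply, proj_self le_rfl hx.2, proj_orth hx.1, sub_zero]

lemma atomP_of_mem (hm : Monotone N) {n k : ℕ} (h : n ≤ k) {x : H} (hx : x ∈ N n) : atomP N k x = 0 := by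
  rw [atomP_apply, proj_self (hm (h.trans (Nat.le_succ k))) hx, proj_self (hm h) hx, sub_self]

lemma atomP_ne (hm : Monotone N) {j k : ℕ} (h : j ≠ k) {x : H} (hx : x ∈ atomE N k) : atomP N j x = 0 := by
  rcases lt_or_gt_of_ne h with h | h
  · have h1 : N (j + 1) ≤ N k := hm h
    have h2 : N j ≤ N k := hm h.le
    rw [atomP_apply, proj_orth (Submodule.orthogonal_le h1 hx.1),
      proj_orth (Submodule.orthogonal_le h2 hx.1), sub_self]
  · exact atomP_of_mem N hm h hx.2

lemma atomE_orth (hm : Monotone N) {j k : ℕ} (h : j ≠ k) {x y : H} (hx : x ∈ atomE N j) (hy : y ∈ atomE N k) :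
    ⟪x, y⟫_ℂ = 0 := by
  rcases lt_or_gt_of_ne h with h | h
  · exact Submodule.inner_right_of_mem_orthogonal (hm h hx.2) hy.1
  · exact Submodule.inner_left_of_mem_orthogonal (hm h hy.2) hx.1

lemma atomP_norm_sq (hm : Monotone N) (k : ℕ) (x : H) :
    ‖(N (k + 1)).starProjection x‖ ^ 2 = ‖(N k).starProjection x‖ ^ 2 + ‖atomP N k x‖ ^ 2 := by
  have h : (N (k + 1)).starProjection x = (N k).starProjection x + atomP N k x := by
    rw [atomP_apply]; abel
  have h0 : ⟪(N k).starProjection x, atomP N k x⟫_ℂ = 0 :=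
    Submodule.inner_right_of_mem_orthogonal (Submodule.starProjection_apply_mem _ _)
      (atomP_mem N hm k x).1
  have := norm_add_sq_eq_norm_sq_add_norm_sq_of_inner_eq_zero _ _ h0
  rw [h]; simpa [sq] using this

lemma sum_atomP_sq (hm : Monotone N) (hbot : N 0 = ⊥) (n : ℕ) (x : H) :
    ∑ k ∈ Finset.range n, ‖atomP N k x‖ ^ 2 = ‖(N n).starProjection x‖ ^ 2 := by
  induction n with
  | zero =>
    have : x ∈ (N 0)ᗮ := by rw [hbot]; simp
    simp [proj_orth this]
  | succ n ih => rw [Finset.sum_range_succ, ih, atomP_norm_sq N hm]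

lemma sum_atomP (hbot : N 0 = ⊥) (n : ℕ) (x : H) :
    ∑ k ∈ Finset.range n, atomP N k x = (N n).starProjection x := by
  induction n with
  | zero =>
    have : x ∈ (N 0)ᗮ := by rw [hbot]; simp
    simp [proj_orth this]
  | succ n ih => rw [Finset.sum_range_succ, ih, atomP_apply]; abel

/-- Operators agreeing on all atoms are equal. -/
lemma ext_atoms (hm : Monotone N) (hbot : N 0 = ⊥) (hsup : (⨆ k, N k).topologicalClosure = ⊤) {S T : H →L[ℂ] H}
    (h : ∀ k, ∀ x ∈ atomE N k, S x = T x) : S = T := by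
  ext x
  have ht := Submodule.starProjection_tendsto_self N hm x hsup.ge
  have hS := (S.continuous.tendsto x).comp ht
  have hT := (T.continuous.tendsto x).comp ht
  refine tendsto_nhds_unique hS (hT.congr fun n => ?_)
  simp only [Function.comp]
  rw [← sum_atomP N hbot n x, map_sum, map_sum]
  exact Finset.sum_congr rfl fun k _ => (h k _ (atomP_mem N hm k x)).symm

lemma blockOp (hm : Monotone N) [CompleteSpace H] (hbot : N 0 = ⊥) (F : ℕ → H →L[ℂ] H)
    (hF : ∀ i j, i ≠ j → ∀ x y, ⟪F i x, F j y⟫_ℂ = 0) (C : ℝ) (hC : 0 ≤ C)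
    (hFC : ∀ k, ‖F k‖ ≤ C) :
    ∃ D : H →L[ℂ] H, ‖D‖ ≤ C ∧ (∀ k, ∀ x ∈ atomE N k, D x = F k x) ∧
      ((∀ k x, F k x ∈ N (k + 1)) → ∀ n, ∀ x ∈ N n, D x ∈ N n) := by
  have hV : OrthogonalFamily ℂ (fun k => (F k : H →ₗ[ℂ] H).range)
      (fun k => ((F k : H →ₗ[ℂ] H).range).subtypeₗᵢ) := by
    rintro i j hij ⟨_, x, rfl⟩ ⟨_, y, rfl⟩
    exact hF i j hij x y
  let l : H → ∀ k, (F k : H →ₗ[ℂ] H).range := fun x k => ⟨F k (atomP N k x), _, rfl⟩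
  have hle : ∀ x k, ‖F k (atomP N k x)‖ ^ 2 ≤ C ^ 2 * ‖atomP N k x‖ ^ 2 := by
    intro x k
    rw [← mul_pow]
    gcongr
    exact (F k).le_of_opNorm_le (hFC k) _
  have hpart : ∀ x n, ∑ k ∈ Finset.range n, ‖F k (atomP N k x)‖ ^ 2 ≤ (C * ‖x‖) ^ 2 := by
    intro x n
    calc _ ≤ ∑ k ∈ Finset.range n, C ^ 2 * ‖atomP N k x‖ ^ 2 :=
          Finset.sum_le_sum fun k _ => hle x k
      _ = C ^ 2 * ‖(N n).starProjection x‖ ^ 2 := by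
          rw [← Finset.mul_sum, sum_atomP_sq N hm hbot]
      _ ≤ C ^ 2 * ‖x‖ ^ 2 := by
          gcongr
          simpa using (N n).starProjection.le_of_opNorm_le (Submodule.starProjection_norm_le _) x
      _ = _ := by rw [mul_pow]
  have hsum : ∀ x, Summable fun k => F k (atomP N k x) := by
    intro x
    refine (hV.summable_iff_norm_sq_summable (l x)).2 ?_
    exact summable_of_sum_range_le (fun k => by positivity) (hpart x)
  have hnorm : ∀ x n, ‖∑ k ∈ Finset.range n, F k (atomP N k x)‖ ≤ C * ‖x‖ := by
    intro x n
    refine le_of_sq_le_sq ?_ (by positivity)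
    have := hV.norm_sum (l x) (Finset.range n)
    exact (this.trans_le (hpart x n))
  let D0 : H →ₗ[ℂ] H :=
    { toFun := fun x => ∑' k, F k (atomP N k x)
      map_add' := fun x y => by
        simp only [map_add]
        exact (hsum x).tsum_add (hsum y)
      map_smul' := fun c x => by
        simp only [map_smul, RingHom.id_apply]
        exact (hsum x).tsum_const_smul c }
  have hD0 : ∀ x, ‖D0 x‖ ≤ C * ‖x‖ := fun x =>
    le_of_tendsto ((hsum x).hasSum.tendsto_sum_nat.norm) (Filter.Eventually.of_forall (hnorm x))
  refine ⟨D0.mkContinuous C hD0, D0.mkContinuous_norm_le hC hD0, ?_, ?_⟩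
  · intro k x hx
    change ∑' k, F k (atomP N k x) = F k x
    rw [tsum_eq_single k, atomP_eq N hx]
    intro j hj
    rw [atomP_ne N hm hj hx, map_zero]
  · intro hr n x hx
    change ∑' k, F k (atomP N k x) ∈ N n
    rw [tsum_eq_sum (s := Finset.range n)]
    · refine sum_mem fun k hk => ?_
      exact hm (Finset.mem_range.1 hk) (hr k _)
    · intro k hk
      rw [atomP_of_mem N hm (by simpa using hk) hx, map_zero]

end block

section final
variable {H : Type*} [NormedAddCommGroup H] [InnerProductSpace ℂ H]

lemma mem_nest_iff (N : ℕ → Submodule ℂ H) (T : H →L[ℂ] H) :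
    T ∈ nestAlgebra (insert ⊤ (Set.range N)) ↔ ∀ n, ∀ x ∈ N n, T x ∈ N n := by
  constructor
  · intro h n x hx
    exact h (N n) (Or.inr ⟨n, rfl⟩) x hx
  · rintro h M (rfl | ⟨n, rfl⟩) x hx
    · trivial
    · exact h n x hx

set_option maxHeartbeats 1000000 in
lemma block_data (N : ℕ → Submodule ℂ H) [∀ k, FiniteDimensional ℂ (N k)]
    (k : ℕ) (A B : H →L[ℂ] H) (hA : ∀ x ∈ N (k + 1), A x ∈ N (k + 1))
    (hB : ∀ x ∈ N (k + 1), B x ∈ N (k + 1))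
    (hd : 4 * Module.finrank ℂ (N k) ≤ Module.finrank ℂ (atomE N k)) (δ : ℝ) (hδ : 0 < δ) :
    ∃ a b X Y : H →L[ℂ] H, ‖a‖ ≤ δ ∧ ‖b‖ ≤ δ ∧ ‖X‖ ≤ δ⁻¹ ∧ ‖Y‖ ≤ δ⁻¹ ∧
      (∀ x, a x ∈ atomE N k) ∧ (∀ x, b x ∈ atomE N k) ∧
      (∀ x, X x ∈ atomE N k) ∧ (∀ x, Y x ∈ atomE N k) ∧
      ∀ x ∈ atomE N k, (A (X x) + a (X x)) + (B (Y x) + b (Y x)) = x := by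
  let Q : H →L[ℂ] N k := (N k).orthogonalProjectionOnto
  let ι : atomE N k →L[ℂ] H := (atomE N k).subtypeL
  let f : atomE N k →ₗ[ℂ] (N k × N k) :=
    LinearMap.prod ((Q ∘L A ∘L ι : atomE N k →L[ℂ] N k) : atomE N k →ₗ[ℂ] N k)
      ((Q ∘L B ∘L ι : atomE N k →L[ℂ] N k) : atomE N k →ₗ[ℂ] N k)
  let K : Submodule ℂ (atomE N k) := f.ker
  have hK : ∀ x : K, A (x : atomE N k) ∈ atomE N k ∧ B (x : atomE N k) ∈ atomE N k := by
    rintro ⟨x, hx⟩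
    have hx' : (Q (A x), Q (B x)) = (0, 0) := hx
    rw [Prod.mk.injEq] at hx'
    refine ⟨⟨?_, hA _ x.2.2⟩, ⟨?_, hB _ x.2.2⟩⟩
    · exact Submodule.orthogonalProjectionOnto_eq_zero_iff.1 hx'.1
    · exact Submodule.orthogonalProjectionOnto_eq_zero_iff.1 hx'.2
  let T : WithLp 2 (K × K) →L[ℂ] atomE N k :=
    ((A ∘L ι ∘L K.subtypeL ∘L WithLp.fstL 2 ℂ K K) +
      (B ∘L ι ∘L K.subtypeL ∘L WithLp.sndL 2 ℂ K K)).codRestrict (atomE N k)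
      (fun x => add_mem (hK x.fst).1 (hK x.snd).2)
  have hfin : Module.finrank ℂ (atomE N k) ≤ Module.finrank ℂ (WithLp 2 (K × K)) := by
    rw [(WithLp.linearEquiv 2 ℂ (K × K)).finrank_eq, Module.finrank_prod]
    have h1 := f.finrank_range_add_finrank_ker
    have h2 := Submodule.finrank_le f.range
    rw [Module.finrank_prod] at h2
    have h3 : Module.finrank ℂ f.ker = Module.finrank ℂ K := rfl
    omega
  obtain ⟨U, R, hU, hR, hUR⟩ :=
    core_perturb (V := WithLp 2 (K × K)) (W := atomE N k) T hfin δ hδ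
  let pK : H →L[ℂ] K := K.orthogonalProjectionOnto ∘L (atomE N k).orthogonalProjectionOnto
  have hpK : ∀ x, ‖pK x‖ ≤ ‖x‖ := by
    intro x
    have h1 := K.orthogonalProjectionOnto.le_of_opNorm_le
      (Submodule.orthogonalProjectionOnto_norm_le K) ((atomE N k).orthogonalProjectionOnto x)
    have h2 := (atomE N k).orthogonalProjectionOnto.le_of_opNorm_le
      (Submodule.orthogonalProjectionOnto_norm_le _) x
    simp only [one_mul] at h1 h2
    exact h1.trans h2
  have hpK' : ∀ x : K, pK (x : atomE N k) = x := by
    intro x; simp [pK]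
  let i1 : K →L[ℂ] WithLp 2 (K × K) :=
    ((WithLp.prodContinuousLinearEquiv 2 ℂ K K).symm : (K × K) →L[ℂ] WithLp 2 (K × K)) ∘L
      ContinuousLinearMap.inl ℂ K K
  let i2 : K →L[ℂ] WithLp 2 (K × K) :=
    ((WithLp.prodContinuousLinearEquiv 2 ℂ K K).symm : (K × K) →L[ℂ] WithLp 2 (K × K)) ∘L
      ContinuousLinearMap.inr ℂ K K
  have hi1 : ∀ x, ‖i1 x‖ = ‖x‖ := fun x => WithLp.norm_toLp_fst 2 K K x
  have hi2 : ∀ x, ‖i2 x‖ = ‖x‖ := fun x => WithLp.norm_toLp_snd 2 K K x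
  have hi : ∀ z : WithLp 2 (K × K), i1 z.fst + i2 z.snd = z := by
    intro z
    apply (WithLp.prodContinuousLinearEquiv 2 ℂ K K).injective
    rw [map_add]
    simp only [i1, i2, ContinuousLinearMap.comp_apply, ContinuousLinearEquiv.coe_coe,
      ContinuousLinearEquiv.apply_symm_apply, ContinuousLinearMap.inl_apply,
      ContinuousLinearMap.inr_apply, Prod.mk_add_mk, add_zero, zero_add]
    rfl
  let pE : H →L[ℂ] atomE N k := (atomE N k).orthogonalProjectionOnto
  have hpE : ∀ x, ‖pE x‖ ≤ ‖x‖ := by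
    intro x
    have h2 := (atomE N k).orthogonalProjectionOnto.le_of_opNorm_le
      (Submodule.orthogonalProjectionOnto_norm_le _) x
    rw [one_mul] at h2
    exact h2
  refine ⟨ι ∘L U ∘L i1 ∘L pK, ι ∘L U ∘L i2 ∘L pK,
    ι ∘L K.subtypeL ∘L WithLp.fstL 2 ℂ K K ∘L R ∘L pE,
    ι ∘L K.subtypeL ∘L WithLp.sndL 2 ℂ K K ∘L R ∘L pE, ?_, ?_, ?_, ?_,
    fun x => Subtype.coe_prop _, fun x => Subtype.coe_prop _, fun x => Subtype.coe_prop _,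
    fun x => Subtype.coe_prop _, ?_⟩
  · refine ContinuousLinearMap.opNorm_le_bound _ hδ.le fun x => ?_
    calc ‖U (i1 (pK x))‖ ≤ δ * ‖i1 (pK x)‖ := U.le_of_opNorm_le hU _
      _ ≤ δ * ‖x‖ := by rw [hi1]; gcongr; exact hpK x
  · refine ContinuousLinearMap.opNorm_le_bound _ hδ.le fun x => ?_
    calc ‖U (i2 (pK x))‖ ≤ δ * ‖i2 (pK x)‖ := U.le_of_opNorm_le hU _
      _ ≤ δ * ‖x‖ := by rw [hi2]; gcongr; exact hpK x
  · refine ContinuousLinearMap.opNorm_le_bound _ (by positivity) fun x => ?_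
    calc ‖(R (pE x)).fst‖ ≤ ‖R (pE x)‖ := WithLp.norm_fst_le _ _ 
      _ ≤ δ⁻¹ * ‖pE x‖ := R.le_of_opNorm_le hR _
      _ ≤ δ⁻¹ * ‖x‖ := by gcongr; exact hpE x
  · refine ContinuousLinearMap.opNorm_le_bound _ (by positivity) fun x => ?_
    calc ‖(R (pE x)).snd‖ ≤ ‖R (pE x)‖ := WithLp.norm_snd_le _ _
      _ ≤ δ⁻¹ * ‖pE x‖ := R.le_of_opNorm_le hR _
      _ ≤ δ⁻¹ * ‖x‖ := by gcongr; exact hpE x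
  · intro x hx
    have hpx : pE x = ⟨x, hx⟩ := by
      exact Submodule.orthogonalProjectionOnto_mem_subspace_eq_self (K := atomE N k) ⟨x, hx⟩
    have h := hUR ⟨x, hx⟩
    set z := R ⟨x, hx⟩ with hz
    have hTz : ((T z : atomE N k) : H) = A (z.fst : atomE N k) + B (z.snd : atomE N k) := rfl
    have hUz : U z = U (i1 z.fst) + U (i2 z.snd) := by rw [← map_add, hi]
    have h' : ((T z : atomE N k) : H) + (U z : atomE N k) = x := congrArg Subtype.val h
    rw [hTz, hUz] at h'
    change (A (((R (pE x)).fst : atomE N k) : H) +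
        (U (i1 (pK ((R (pE x)).fst : atomE N k))) : H)) +
      (B (((R (pE x)).snd : atomE N k) : H) +
        (U (i2 (pK ((R (pE x)).snd : atomE N k))) : H)) = x
    rw [hpx, hpK', hpK', ← hz]
    rw [Submodule.coe_add] at h'
    rw [← h']
    abel

variable [CompleteSpace H]

lemma approx_two (N : ℕ → Submodule ℂ H) [∀ k, FiniteDimensional ℂ (N k)] (hm : Monotone N)
    (hbot : N 0 = ⊥) (hsup : (⨆ k, N k).topologicalClosure = ⊤)
    (hd : ∀ k, 4 * Module.finrank ℂ (N k) ≤ Module.finrank ℂ (atomE N k))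
    (A B : H →L[ℂ] H) (hA : ∀ n, ∀ x ∈ N n, A x ∈ N n) (hB : ∀ n, ∀ x ∈ N n, B x ∈ N n)
    (δ : ℝ) (hδ : 0 < δ) :
    ∃ a b X Y : H →L[ℂ] H, ‖a‖ ≤ δ ∧ ‖b‖ ≤ δ ∧ (∀ n, ∀ x ∈ N n, a x ∈ N n) ∧
      (∀ n, ∀ x ∈ N n, b x ∈ N n) ∧ (∀ n, ∀ x ∈ N n, X x ∈ N n) ∧
      (∀ n, ∀ x ∈ N n, Y x ∈ N n) ∧ (A + a) * X + (B + b) * Y = 1 := by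
  choose a b X Y ha hb hX hY ha' hb' hX' hY' h using fun k =>
    block_data N k A B (hA _) (hB _) (hd k) δ hδ
  obtain ⟨a₀, ha0, ha1, ha2⟩ := blockOp N hm hbot a
    (fun i j hij x y => atomE_orth N hm hij (ha' i x) (ha' j y)) δ hδ.le ha
  obtain ⟨b₀, hb0, hb1, hb2⟩ := blockOp N hm hbot b
    (fun i j hij x y => atomE_orth N hm hij (hb' i x) (hb' j y)) δ hδ.le hb
  obtain ⟨X₀, hX0, hX1, hX2⟩ := blockOp N hm hbot X
    (fun i j hij x y => atomE_orth N hm hij (hX' i x) (hX' j y)) δ⁻¹ (by positivity) hX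
  obtain ⟨Y₀, hY0, hY1, hY2⟩ := blockOp N hm hbot Y
    (fun i j hij x y => atomE_orth N hm hij (hY' i x) (hY' j y)) δ⁻¹ (by positivity) hY
  refine ⟨a₀, b₀, X₀, Y₀, ha0, hb0, ha2 fun k x => (ha' k x).2, hb2 fun k x => (hb' k x).2,
    hX2 fun k x => (hX' k x).2, hY2 fun k x => (hY' k x).2, ?_⟩
  refine ext_atoms N hm hbot hsup fun k x hx => ?_
  change (A (X₀ x) + a₀ (X₀ x)) + (B (Y₀ x) + b₀ (Y₀ x)) = x
  rw [hX1 k x hx, hY1 k x hx, ha1 k _ (hX' k x), hb1 k _ (hY' k x)]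
  exact h k x hx

lemma left_inv_of_right_inv (N : ℕ → Submodule ℂ H) [∀ k, FiniteDimensional ℂ (N k)]
    (hm : Monotone N) (hbot : N 0 = ⊥) (hsup : (⨆ k, N k).topologicalClosure = ⊤)
    (A X : H →L[ℂ] H) (hX : ∀ n, ∀ x ∈ N n, X x ∈ N n) (h : A * X = 1) : X * A = 1 := by
  have h' : ∀ x, A (X x) = x := fun x => congrArg (fun f : H →L[ℂ] H => f x) h
  refine ext_atoms N hm hbot hsup fun k x hx => ?_
  let g : N (k + 1) →ₗ[ℂ] N (k + 1) := (X : H →ₗ[ℂ] H).restrict (hX (k + 1))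
  have hg : Function.Injective g := by
    intro x y hxy
    have : X x = X y := congrArg Subtype.val hxy
    ext
    rw [← h' x, this, h' y]
  obtain ⟨z, hz⟩ := LinearMap.surjective_of_injective hg ⟨x, hx.2⟩
  have hz' : X z = x := congrArg Subtype.val hz
  change X (A x) = x
  rw [← hz', h']

lemma shift_exists (N : ℕ → Submodule ℂ H) [∀ k, FiniteDimensional ℂ (N k)] (hm : Monotone N)
    (hbot : N 0 = ⊥) (hsup : (⨆ k, N k).topologicalClosure = ⊤)
    (hd : ∀ k, 0 < Module.finrank ℂ (atomE N k)) :
    ∃ C S : H →L[ℂ] H, (∀ n, ∀ x ∈ N n, C x ∈ N n) ∧ C * S = 1 ∧ ∃ e, e ≠ 0 ∧ C e = 0 := by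
  have hex : ∀ k, ∃ e ∈ atomE N k, ‖e‖ = 1 := by
    intro k
    have := Module.finrank_pos_iff.1 (hd k)
    obtain ⟨e, he⟩ := exists_norm_eq (atomE N k) (zero_le_one' ℝ)
    exact ⟨e, e.2, he⟩
  choose e he hen using hex
  have hee : ∀ k, ⟪e k, e k⟫_ℂ = 1 := fun k => by
    rw [inner_self_eq_norm_sq_to_K, hen]; simp
  let f : ℕ → H := fun k => Nat.casesOn k 0 (fun j => e j)
  have hf0 : f 0 = 0 := rfl
  have hfs : ∀ k, f (k + 1) = e k := fun _ => rfl
  have hfn : ∀ k, ‖f k‖ ≤ 1 := by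
    rintro (_ | k)
    · simp [hf0]
    · simp [hfs, hen]
  have hnorm : ∀ k (v : H), ‖v‖ ≤ 1 → ‖(innerSL ℂ (e k)).smulRight v‖ ≤ 1 := by
    intro k v hv
    rw [ContinuousLinearMap.norm_smulRight_apply, innerSL_apply_norm, hen, one_mul]
    exact hv
  obtain ⟨D0, -, h0, h0'⟩ := blockOp N hm hbot (fun k => (innerSL ℂ (e k)).smulRight (e k))
    (fun i j hij x y => atomE_orth N hm hij ((atomE N i).smul_mem _ (he i))
      ((atomE N j).smul_mem _ (he j))) 1 zero_le_one (fun k => hnorm k _ (hen k).le)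
  obtain ⟨D1, -, h1, -⟩ := blockOp N hm hbot (fun k => (innerSL ℂ (e k)).smulRight (e (k + 1)))
    (fun i j hij x y => atomE_orth N hm (by omega : i + 1 ≠ j + 1)
      ((atomE N _).smul_mem _ (he _)) ((atomE N _).smul_mem _ (he _))) 1 zero_le_one
      (fun k => hnorm k _ (hen _).le)
  obtain ⟨D2, -, h2, h2'⟩ := blockOp N hm hbot (fun k => (innerSL ℂ (e k)).smulRight (f k))
    (fun i j hij x y => by
      rcases i with _ | i
      · simp [hf0]
      rcases j with _ | j
      · simp [hf0]
      exact atomE_orth N hm (by omega : i ≠ j)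
        ((atomE N _).smul_mem _ (he _)) ((atomE N _).smul_mem _ (he _))) 1 zero_le_one
      (fun k => hnorm k _ (hfn _))
  replace h0 : ∀ k, ∀ x ∈ atomE N k, D0 x = ⟪e k, x⟫_ℂ • e k := h0
  replace h1 : ∀ k, ∀ x ∈ atomE N k, D1 x = ⟪e k, x⟫_ℂ • e (k + 1) := h1
  replace h2 : ∀ k, ∀ x ∈ atomE N k, D2 x = ⟪e k, x⟫_ℂ • f k := h2
  have hfm : ∀ k, f k ∈ N (k + 1) := by
    rintro (_ | k)
    · exact zero_mem _
    · exact hm (Nat.le_succ _) (he k).2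
  refine ⟨1 - D0 + D2, 1 - D0 + D1, ?_, ?_, e 0, ?_, ?_⟩
  · intro n x hx
    exact add_mem (sub_mem hx (h0' (fun k y => (N _).smul_mem _ (he k).2) n x hx))
      (h2' (fun k y => (N _).smul_mem _ (hfm k)) n x hx)
  · refine ext_atoms N hm hbot hsup fun k x hx => ?_
    change ((x - D0 x + D1 x) - D0 (x - D0 x + D1 x)) + D2 (x - D0 x + D1 x) = x
    simp only [h0 k x hx, h1 k x hx, map_add, map_sub, map_smul, h2 k x hx, h0 _ _ (he _),
      h2 _ _ (he _), hee, hfs, one_smul]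
    abel
  · intro h
    have := hen 0
    rw [h] at this
    simp at this
  · change e 0 - D0 (e 0) + D2 (e 0) = 0
    rw [h0 0 _ (he 0), h2 0 _ (he 0), hee, hf0]
    simp

end final

/-- For the nest `{0} = N₀ < N₁ < ⋯` ordered like `ℕ` with finite-dimensional atoms of
ranks `nk k` satisfying `nk k ≥ 4 ∑_{i<k} nk i`, the right topological stable rank of the
nest algebra is `2`. -/
theorem stmt17 {H : Type*} [NormedAddCommGroup H] [InnerProductSpace ℂ H] [CompleteSpace H]
    (N : ℕ → Submodule ℂ H) (hbot : N 0 = ⊥) (hmono : StrictMono N)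
    (hfd : ∀ k, FiniteDimensional ℂ (N k)) (nk : ℕ → ℕ)
    (hrank : ∀ k, Module.finrank ℂ (N (k + 1)) = Module.finrank ℂ (N k) + nk (k + 1))
    (hgrow : ∀ k, 1 ≤ k → 4 * ∑ i ∈ Finset.Ico 1 k, nk i ≤ nk k)
    (hsup : (⨆ k, N k).topologicalClosure = ⊤) :
    rtsr (nestAlgebra (insert ⊤ (Set.range N))) = 2 := by
  have hm := hmono.monotone
  have hE : ∀ k, Module.finrank ℂ (atomE N k) = nk (k + 1) := by
    intro k
    have h1 := Submodule.finrank_add_inf_finrank_orthogonal (hm (Nat.le_succ k))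
    have h2 := hrank k
    have h3 : Module.finrank ℂ (atomE N k) = Module.finrank ℂ ↥((N k)ᗮ ⊓ N (k + 1)) := rfl
    rw [Nat.succ_eq_add_one] at h1
    omega
  have hNk : ∀ k, Module.finrank ℂ (N k) = ∑ i ∈ Finset.Ico 1 (k + 1), nk i := by
    intro k
    induction k with
    | zero => rw [hbot]; simp
    | succ k ih => rw [hrank, ih, Finset.sum_Ico_succ_top (by omega : 1 ≤ k + 1)]
  have hd : ∀ k, 4 * Module.finrank ℂ (N k) ≤ Module.finrank ℂ (atomE N k) := by
    intro k
    rw [hE, hNk]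
    exact hgrow (k + 1) (by omega)
  have hpos : ∀ k, 0 < Module.finrank ℂ (atomE N k) := by
    intro k
    have h1 := Submodule.finrank_lt_finrank_of_lt (hmono (Nat.lt_succ_self k))
    have h2 := hrank k
    rw [hE]
    rw [Nat.succ_eq_add_one] at h1
    omega
  obtain ⟨C, S, hC, hCS, e, he, hCe⟩ := shift_exists N hm hbot hsup hpos
  have : Nontrivial H := ⟨e, 0, he⟩
  unfold rtsr
  apply le_antisymm
  · refine sInf_le ⟨2, rfl, ?_⟩
    rw [Metric.dense_iff]
    intro p ε hε
    obtain ⟨a, b, X, Y, ha, hb, ha', hb', hX, hY, h⟩ := approx_two N hm hbot hsup hd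
      (p 0 : H →L[ℂ] H) (p 1 : H →L[ℂ] H) ((mem_nest_iff N _).1 (p 0).2)
      ((mem_nest_iff N _).1 (p 1).2) (ε / 2) (by positivity)
    refine ⟨![p 0 + ⟨a, (mem_nest_iff N _).2 ha'⟩, p 1 + ⟨b, (mem_nest_iff N _).2 hb'⟩], ?_,
      ![⟨X, (mem_nest_iff N _).2 hX⟩, ⟨Y, (mem_nest_iff N _).2 hY⟩], ?_⟩
    · rw [Metric.mem_ball, dist_pi_lt_iff hε]
      intro i
      fin_cases i
      · simp only [Fin.zero_eta, Matrix.cons_val_zero, dist_self_add_left]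
        exact ha.trans_lt (by linarith)
      · simp only [Fin.mk_one, Matrix.cons_val_one, Matrix.cons_val_fin_one, dist_self_add_left]
        exact hb.trans_lt (by linarith)
    · rw [Fin.sum_univ_two]
      exact Subtype.ext h
  · refine le_sInf ?_
    rintro _ ⟨n, rfl, hn⟩
    by_contra hlt
    have hn2 : n < 2 := by
      rw [not_le] at hlt
      exact_mod_cast hlt
    interval_cases n
    · obtain ⟨x, b, hb⟩ := hn.nonempty
      rw [Fin.sum_univ_zero] at hb
      have : (0 : H →L[ℂ] H) = 1 := congrArg Subtype.val hb
      exact zero_ne_one this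
    · have hr : 0 < (‖S‖ + 1)⁻¹ := by positivity
      rw [Metric.dense_iff] at hn
      obtain ⟨q, hq, b, hb⟩ := hn (fun _ => ⟨C, (mem_nest_iff N _).2 hC⟩) _ hr
      rw [Fin.sum_univ_one] at hb
      have hAX : (q 0 : H →L[ℂ] H) * (b 0 : H →L[ℂ] H) = 1 := congrArg Subtype.val hb
      have hXA := left_inv_of_right_inv N hm hbot hsup _ _ ((mem_nest_iff N _).1 (b 0).2) hAX
      rw [Metric.mem_ball, dist_pi_lt_iff hr] at hq
      have hq0 : ‖(q 0 : H →L[ℂ] H) - C‖ < (‖S‖ + 1)⁻¹ := by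
        have := hq 0
        rw [dist_eq_norm] at this
        exact this
      set A : H →L[ℂ] H := (q 0 : H →L[ℂ] H)
      have hsm : ‖(C - A) * S‖ < 1 := by
        calc ‖(C - A) * S‖ ≤ ‖C - A‖ * ‖S‖ := norm_mul_le _ _
          _ ≤ ‖C - A‖ * (‖S‖ + 1) := by gcongr; linarith
          _ < (‖S‖ + 1)⁻¹ * (‖S‖ + 1) := by
            rw [norm_sub_rev]; gcongr
          _ = 1 := inv_mul_cancel₀ (by positivity)
      have hu := isUnit_one_sub_of_norm_lt_one hsm
      have hAS : 1 - (C - A) * S = A * S := by rw [sub_mul, hCS]; abel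
      rw [hAS] at hu
      have hAu : IsUnit (b 0 : H →L[ℂ] H) := ⟨⟨_, _, hXA, hAX⟩, rfl⟩
      have hSu : IsUnit S := by
        have := hAu.mul hu
        rwa [← mul_assoc, hXA, one_mul] at this
      obtain ⟨⟨s, t, hst, hts⟩, rfl⟩ := hSu
      have hCt : C = t := by
        calc C = C * (s * t) := by rw [hst, mul_one]
          _ = t := by rw [← mul_assoc, show C * s = 1 from hCS, one_mul]
      have : s (C e) = e := by
        rw [hCt]
        exact congrArg (fun f : H →L[ℂ] H => f e) hst
      rw [hCe, map_zero] at this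
      exact he this.symm
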